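/- Let ρ : [0,∞) → [0,∞) be a smooth function with ρ(0) = 0, ρ'(0) = 1, ρ^{(2j)}(0) = 0 for all j ∈ ℕ, ρ(r) > 0 for r > 0, and ρ'' ≥ 0 on [0,∞). Let σ : [0,∞) → [0,∞) be of hyperbolic type. Fix R̄ > 0. Then for every R > R̄ there exist k ≥ 1 and a smooth function τ : [0,∞) → [0,∞) such that: τ(r) = ρ(r) for all r ∈ [0,R̄]; τ(r) = σ_k(r) for all r ∈ [R,∞); τ'' ≥ 0 on [0,∞); and τ' ≥ 1 on [0,∞), where σ_k(r) := k^{-1/2} σ(k^{1/2} r). -/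

import Mathlib

/-- The rescaled warping function `σ_k(r) = k^{-1/2} σ(k^{1/2} r)`. -/
noncomputable def sigmaK (σ : ℝ → ℝ) (k r : ℝ) : ℝ :=
  (Real.sqrt k)⁻¹ * σ (Real.sqrt k * r)

/-- A smooth function `σ : [0,∞) → [0,∞)` (modelled as a smooth function on `ℝ` whose
relevant properties are stated on `[0,∞)`) is of *hyperbolic type* if `σ(0) = 0`,
`σ'(0) = 1`, all even-order derivatives vanish at `0`, `σ > 0` on `(0,∞)`, `σ'' ≥ 0`
on `[0,∞)`, for every `k ≥ 1` and `r > 0` one has `σ_k'(r) ≥ σ_k(r)`, and for every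
fixed `r > 0`, `σ_k(r) → +∞` as `k → +∞`. -/
def IsHyperbolicType (σ : ℝ → ℝ) : Prop :=
  ContDiff ℝ (⊤ : ℕ∞) σ ∧ σ 0 = 0 ∧ deriv σ 0 = 1 ∧
    (∀ j : ℕ, iteratedDeriv (2 * j) σ 0 = 0) ∧
    (∀ r : ℝ, 0 < r → 0 < σ r) ∧ (∀ r : ℝ, 0 ≤ r → 0 ≤ σ r) ∧
    (∀ r : ℝ, 0 ≤ r → 0 ≤ iteratedDeriv 2 σ r) ∧
    (∀ k : ℝ, 1 ≤ k → ∀ r : ℝ, 0 < r → sigmaK σ k r ≤ deriv (sigmaK σ k) r) ∧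
    (∀ r : ℝ, 0 < r → Filter.Tendsto (fun k : ℝ => sigmaK σ k r) Filter.atTop Filter.atTop)

open Set Filter

/-- A function with nonnegative derivative on a convex set is monotone there. -/
lemma monotoneOn_of_differentiable {D : Set ℝ} (hD : Convex ℝ D) {f : ℝ → ℝ}
    (hf : Differentiable ℝ f) (hf' : ∀ x ∈ D, 0 ≤ deriv f x) : MonotoneOn f D :=
  monotoneOn_of_deriv_nonneg hD hf.continuous.continuousOn hf.differentiableOn
    fun x hx => hf' x (interior_subset hx)

/-- Two differentiable functions with the same derivative on a convex set, agreeing at one of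
its points, agree on the whole set. -/
lemma eqOn_of_deriv_eqOn {D : Set ℝ} (hD : Convex ℝ D) {f g : ℝ → ℝ}
    (hf : Differentiable ℝ f) (hg : Differentiable ℝ g) (hfg : EqOn (deriv f) (deriv g) D)
    {c : ℝ} (hc : c ∈ D) (h : f c = g c) : EqOn f g D := by
  have h1 : MonotoneOn (f - g) D := monotoneOn_of_differentiable hD (hf.sub hg) fun x hx => by
    rw [deriv_sub (hf x) (hg x), hfg hx, sub_self]
  have h2 : MonotoneOn (g - f) D := monotoneOn_of_differentiable hD (hg.sub hf) fun x hx => by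
    rw [deriv_sub (hg x) (hf x), hfg hx, sub_self]
  intro x hx
  rcases le_total c x with hcx | hcx
  · have a1 := h1 hc hx hcx
    have a2 := h2 hc hx hcx
    simp only [Pi.sub_apply] at a1 a2
    linarith
  · have a1 := h1 hx hc hcx
    have a2 := h2 hx hc hcx
    simp only [Pi.sub_apply] at a1 a2
    linarith

lemma differentiable_of_smooth {f : ℝ → ℝ} (hf : ContDiff ℝ (⊤ : ℕ∞) f) :
    Differentiable ℝ f :=
  (contDiff_infty_iff_deriv.1 hf).1

lemma contDiff_deriv_of_smooth {f : ℝ → ℝ} (hf : ContDiff ℝ (⊤ : ℕ∞) f) :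
    ContDiff ℝ (⊤ : ℕ∞) (deriv f) :=
  (contDiff_infty_iff_deriv.1 hf).2

lemma iteratedDeriv_two_eq (f : ℝ → ℝ) : iteratedDeriv 2 f = deriv (deriv f) := by
  rw [iteratedDeriv_succ, iteratedDeriv_one]

/-- A smooth function has a smooth primitive with prescribed value at a point. -/
lemma exists_smooth_primitive {f : ℝ → ℝ} (hf : ContDiff ℝ (⊤ : ℕ∞) f) (c A : ℝ) :
    ∃ F : ℝ → ℝ, ContDiff ℝ (⊤ : ℕ∞) F ∧ F c = A ∧ deriv F = f := by
  have h : ∀ x, HasDerivAt (fun u => A + ∫ t in c..u, f t) (f x) x := fun x =>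
    (intervalIntegral.integral_hasDerivAt_right (hf.continuous.intervalIntegrable _ _)
      (hf.continuous.stronglyMeasurableAtFilter _ _) hf.continuous.continuousAt).const_add A
  have hd : deriv (fun u => A + ∫ t in c..u, f t) = f := funext fun x => (h x).deriv
  exact ⟨_, contDiff_infty_iff_deriv.2 ⟨fun x => (h x).differentiableAt, by rwa [hd]⟩,
    by simp, hd⟩

/-- A smooth function has a smooth second primitive with prescribed value and slope at a
point. -/
lemma exists_smooth_second_primitive {f : ℝ → ℝ} (hf : ContDiff ℝ (⊤ : ℕ∞) f) (c A B : ℝ) :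
    ∃ F : ℝ → ℝ, ContDiff ℝ (⊤ : ℕ∞) F ∧ F c = A ∧ deriv F c = B ∧ deriv (deriv F) = f := by
  obtain ⟨G, hG, hGc, hG'⟩ := exists_smooth_primitive hf c B
  obtain ⟨F, hF, hFc, hF'⟩ := exists_smooth_primitive hG c A
  exact ⟨F, hF, hFc, by rw [hF', hGc], by rw [hF', hG']⟩

/-- A smooth cutoff rising from `0` on `(-∞, p]` to `1` on `[q, ∞)`. -/
lemma exists_smooth_cutoff {p q : ℝ} (hpq : p < q) :
    ∃ χ : ℝ → ℝ, ContDiff ℝ (⊤ : ℕ∞) χ ∧ (∀ x, 0 ≤ χ x) ∧ (∀ x, χ x ≤ 1) ∧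
      (∀ x ≤ p, χ x = 0) ∧ (∀ x, q ≤ x → χ x = 1) := by
  have h : 0 < q - p := sub_pos.2 hpq
  refine ⟨fun x => Real.smoothTransition ((x - p) / (q - p)),
    Real.smoothTransition.contDiff.comp ((contDiff_id.sub contDiff_const).div_const _),
    fun x => Real.smoothTransition.nonneg _, fun x => Real.smoothTransition.le_one _,
    fun x hx => Real.smoothTransition.zero_of_nonpos
      (div_nonpos_of_nonpos_of_nonneg (by linarith) h.le),
    fun x hx => Real.smoothTransition.one_of_one_le ?_⟩
  rw [le_div_iff₀ h]
  linarith

/-- A smooth convex nondecreasing regularization of `t ↦ max t 0`. -/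
lemma exists_smooth_posPart :
    ∃ (φ : ℝ → ℝ) (N : ℝ), ContDiff ℝ (⊤ : ℕ∞) φ ∧ (∀ t, 0 ≤ deriv φ t) ∧
      (∀ t, deriv φ t ≤ 1) ∧ (∀ t, 0 ≤ deriv (deriv φ) t) ∧
      (∀ t ≤ -N, φ t = 0) ∧ (∀ t, N ≤ t → φ t = t) ∧ (∀ t, N ≤ t → deriv φ t = 1) := by
  obtain ⟨Φ, hΦ, hΦ0, hΦ'⟩ := exists_smooth_primitive
    (f := Real.smoothTransition) Real.smoothTransition.contDiff 0 0
  have hΦd := differentiable_of_smooth hΦ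
  have hlow : EqOn Φ (fun _ => 0) (Iic 0) :=
    eqOn_of_deriv_eqOn (convex_Iic 0) hΦd (differentiable_const 0) (fun x hx => by
      rw [hΦ', Real.smoothTransition.zero_of_nonpos hx, deriv_const]) (mem_Iic.2 le_rfl) hΦ0
  have hhigh : EqOn Φ (fun t => t + (Φ 1 - 1)) (Ici 1) :=
    eqOn_of_deriv_eqOn (convex_Ici 1) hΦd (differentiable_id.add_const _) (fun x hx => by
      rw [hΦ', Real.smoothTransition.one_of_one_le hx]
      simp) (mem_Ici.2 le_rfl) (by ring)
  set d := Φ 1 - 1 with hd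
  have hφ' : deriv (fun t => Φ (t - d)) = fun t => Real.smoothTransition (t - d) := by
    ext t
    rw [deriv_comp_sub_const, hΦ']
  refine ⟨fun t => Φ (t - d), 1 + |d|, hΦ.comp (contDiff_id.sub contDiff_const), ?_, ?_, ?_,
    ?_, ?_, ?_⟩
  · intro t
    rw [hφ']
    exact Real.smoothTransition.nonneg _
  · intro t
    rw [hφ']
    exact Real.smoothTransition.le_one _
  · intro t
    rw [hφ', deriv_comp_sub_const]
    exact Real.smoothTransition.monotone.deriv_nonneg
  · intro t ht
    exact hlow (mem_Iic.2 (by linarith [neg_abs_le d]))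
  · intro t ht
    have := hhigh (show t - d ∈ Ici 1 from mem_Ici.2 (by linarith [le_abs_self d]))
    simpa using this
  · intro t ht
    rw [hφ']
    exact Real.smoothTransition.one_of_one_le (by linarith [le_abs_self d])

/-- First two derivatives of the regularized maximum `v + φ (u - v)`. -/
lemma deriv_regularized_max {u v φ : ℝ → ℝ} (hu : ContDiff ℝ (⊤ : ℕ∞) u)
    (hv : ContDiff ℝ (⊤ : ℕ∞) v) (hφ : ContDiff ℝ (⊤ : ℕ∞) φ) :
    (∀ r, deriv (fun r => v r + φ (u r - v r)) r =
      deriv v r + deriv φ (u r - v r) * (deriv u r - deriv v r)) ∧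
    (∀ r, deriv (deriv (fun r => v r + φ (u r - v r))) r =
      deriv (deriv v) r + (deriv (deriv φ) (u r - v r) * (deriv u r - deriv v r) *
        (deriv u r - deriv v r) +
        deriv φ (u r - v r) * (deriv (deriv u) r - deriv (deriv v) r))) := by
  have D : ∀ {f : ℝ → ℝ}, ContDiff ℝ (⊤ : ℕ∞) f → ∀ r, HasDerivAt f (deriv f r) r :=
    fun hf r => (differentiable_of_smooth hf r).hasDerivAt
  have h1 : ∀ r, deriv (fun r => v r + φ (u r - v r)) r =
      deriv v r + deriv φ (u r - v r) * (deriv u r - deriv v r) := fun r =>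
    ((D hv r).add ((D hφ _).comp r ((D hu r).sub (D hv r)))).deriv
  refine ⟨h1, fun r => ?_⟩
  rw [funext h1]
  have hu' := contDiff_deriv_of_smooth hu
  have hv' := contDiff_deriv_of_smooth hv
  have hφ' := contDiff_deriv_of_smooth hφ
  exact ((D hv' r).add (((D hφ' _).comp r ((D hu r).sub (D hv r))).mul
    ((D hu' r).sub (D hv' r)))).deriv

/-- Cutting off the second derivative to the right of `a`: a smooth function that is convex
where `ρ` is, agrees with `ρ` on `(-∞, a]`, and has constant slope on `[b, ∞)`. -/
lemma exists_affine_extension_right {ρ : ℝ → ℝ} (hρ : ContDiff ℝ (⊤ : ℕ∞) ρ) {a b : ℝ}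
    (hab : a < b) :
    ∃ u : ℝ → ℝ, ContDiff ℝ (⊤ : ℕ∞) u ∧
      (∀ r, 0 ≤ deriv (deriv ρ) r → 0 ≤ deriv (deriv u) r) ∧
      EqOn u ρ (Iic a) ∧ EqOn (deriv u) (deriv ρ) (Iic a) ∧
      (∀ r, b ≤ r → deriv u r = deriv u b) := by
  obtain ⟨χ, hχ, hχ0, hχ1, hχp, hχq⟩ := exists_smooth_cutoff hab
  have hρ' := contDiff_deriv_of_smooth hρ
  have hρ'' := contDiff_deriv_of_smooth hρ'
  obtain ⟨u, hu, hua, hua', hu''⟩ := exists_smooth_second_primitive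
    (f := fun r => (1 - χ r) * deriv (deriv ρ) r) ((contDiff_const.sub hχ).mul hρ'')
    a (ρ a) (deriv ρ a)
  have hd := differentiable_of_smooth (contDiff_deriv_of_smooth hu)
  have hslope : EqOn (deriv u) (deriv ρ) (Iic a) :=
    eqOn_of_deriv_eqOn (convex_Iic a) hd (differentiable_of_smooth hρ')
      (fun x hx => by rw [hu'']; simp [hχp x hx]) (mem_Iic.2 le_rfl) hua'
  refine ⟨u, hu, fun r hr => ?_, ?_, hslope, fun r hr => ?_⟩
  · rw [hu'']
    exact mul_nonneg (sub_nonneg.2 (hχ1 r)) hr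
  · exact eqOn_of_deriv_eqOn (convex_Iic a) (differentiable_of_smooth hu)
      (differentiable_of_smooth hρ) hslope (mem_Iic.2 le_rfl) hua
  · exact eqOn_of_deriv_eqOn (g := fun _ => deriv u b) (convex_Ici b) hd
      (differentiable_const _) (fun x hx => by rw [hu'']; simp [hχq x hx])
      (mem_Ici.2 le_rfl) rfl hr

/-- Cutting off the second derivative to the left of `b`: a smooth function that is convex
where `S` is, agrees with `S` on `[b, ∞)`, and on `(-∞, c]` lies below the tangent line of
`S` at `c`, for a function `S` that is convex on `[c, b]`. -/
lemma exists_affine_extension_left {S : ℝ → ℝ} (hS : ContDiff ℝ (⊤ : ℕ∞) S) {c b : ℝ}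
    (hcb : c < b) (hconv : ∀ r ∈ Icc c b, 0 ≤ deriv (deriv S) r) :
    ∃ v : ℝ → ℝ, ContDiff ℝ (⊤ : ℕ∞) v ∧
      (∀ r, 0 ≤ deriv (deriv S) r → 0 ≤ deriv (deriv v) r) ∧ EqOn v S (Ici b) ∧
      EqOn (deriv v) (deriv S) (Ici b) ∧
      (∀ r ≤ c, v r ≤ S c - deriv S c * (c - r)) := by
  obtain ⟨χ, hχ, hχ0, hχ1, hχp, hχq⟩ := exists_smooth_cutoff hcb
  have hS' := contDiff_deriv_of_smooth hS
  have hS'' := contDiff_deriv_of_smooth hS'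
  obtain ⟨v, hv, hvb, hvb', hv''⟩ := exists_smooth_second_primitive
    (f := fun r => χ r * deriv (deriv S) r) (hχ.mul hS'') b (S b) (deriv S b)
  have hvd := differentiable_of_smooth hv
  have hSd := differentiable_of_smooth hS
  have hvd' := differentiable_of_smooth (contDiff_deriv_of_smooth hv)
  have hSd' := differentiable_of_smooth hS'
  have hslope : EqOn (deriv v) (deriv S) (Ici b) :=
    eqOn_of_deriv_eqOn (convex_Ici b) hvd' hSd'
      (fun x hx => by rw [hv'']; simp [hχq x hx]) (mem_Ici.2 le_rfl) hvb'
  have hc : c ∈ Icc c b := left_mem_Icc.2 hcb.le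
  have hb : b ∈ Icc c b := right_mem_Icc.2 hcb.le
  have hmono' : MonotoneOn (deriv S - deriv v) (Icc c b) :=
    monotoneOn_of_differentiable (convex_Icc c b) (hSd'.sub hvd') fun x hx => by
      rw [deriv_sub (hSd' x) (hvd' x), hv'']
      nlinarith [hconv x hx, hχ1 x]
  have hle' : ∀ x ∈ Icc c b, deriv S x ≤ deriv v x := fun x hx => by
    have := hmono' hx hb hx.2
    simp only [Pi.sub_apply] at this
    linarith
  have hmono : MonotoneOn (v - S) (Icc c b) :=
    monotoneOn_of_differentiable (convex_Icc c b) (hvd.sub hSd) fun x hx => by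
      rw [deriv_sub (hvd x) (hSd x)]
      linarith [hle' x hx]
  have hvc : v c ≤ S c := by
    have := hmono hc hb hcb.le
    simp only [Pi.sub_apply] at this
    linarith
  have hlin' : EqOn (deriv v) (fun _ => deriv v c) (Iic c) :=
    eqOn_of_deriv_eqOn (convex_Iic c) hvd' (differentiable_const _)
      (fun x hx => by rw [hv'']; simp [hχp x hx]) (mem_Iic.2 le_rfl) rfl
  have hlin : EqOn v (fun r => deriv v c * r + (v c - deriv v c * c)) (Iic c) :=
    eqOn_of_deriv_eqOn (convex_Iic c) hvd ((differentiable_id.const_mul _).add_const _)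
      (fun x hx => by
        rw [hlin' hx]
        simp) (mem_Iic.2 le_rfl) (by ring)
  refine ⟨v, hv, fun r hr => ?_, ?_, hslope, fun r hr => ?_⟩
  · rw [hv'']
    exact mul_nonneg (hχ0 r) hr
  · exact eqOn_of_deriv_eqOn (convex_Ici b) hvd hSd hslope (mem_Ici.2 le_rfl) hvb
  · rw [hlin (mem_Iic.2 hr)]
    nlinarith [hle' c hc]

lemma contDiff_sigmaK {σ : ℝ → ℝ} (hσ : ContDiff ℝ (⊤ : ℕ∞) σ) (k : ℝ) :
    ContDiff ℝ (⊤ : ℕ∞) (sigmaK σ k) :=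
  contDiff_const.mul (hσ.comp (contDiff_const.mul contDiff_id))

lemma deriv_sigmaK {σ : ℝ → ℝ} {k : ℝ} (hk : 0 < k) :
    deriv (sigmaK σ k) = fun r => deriv σ (√k * r) := by
  have hs : √k ≠ 0 := (Real.sqrt_pos.2 hk).ne'
  ext r
  change deriv (fun r => (√k)⁻¹ * σ (√k * r)) r = _
  rw [deriv_const_mul_field, deriv_comp_mul_left, smul_eq_mul, inv_mul_cancel_left₀ hs]

lemma deriv_deriv_sigmaK {σ : ℝ → ℝ} {k : ℝ} (hk : 0 < k) (r : ℝ) :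
    deriv (deriv (sigmaK σ k)) r = √k * deriv (deriv σ) (√k * r) := by
  rw [deriv_sigmaK hk, deriv_comp_mul_left, smul_eq_mul]

lemma sqrt_mul_sigmaK_le_deriv {σ : ℝ → ℝ} (hσ : IsHyperbolicType σ) {k r : ℝ} (hk : 0 < k)
    (hr : 0 < r) : √k * sigmaK σ k r ≤ deriv (sigmaK σ k) r := by
  obtain ⟨-, -, -, -, -, -, -, h, -⟩ := hσ
  have hs : 0 < √k := Real.sqrt_pos.2 hk
  have h1 := h 1 le_rfl (√k * r) (mul_pos hs hr)
  rw [deriv_sigmaK one_pos] at h1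
  rw [deriv_sigmaK hk]
  simpa [sigmaK, mul_inv_cancel_left₀ hs.ne'] using h1


/-- Gluing a non-positively curved rotationally symmetric warping
function `ρ` to a rescaled hyperbolic-type warping function `σ_k` outside a large ball,
keeping convexity (`τ'' ≥ 0`, i.e. non-positive radial curvature) and `τ' ≥ 1`. -/
theorem gluing_warping_functions (ρ σ : ℝ → ℝ)
    (hρsmooth : ContDiff ℝ (⊤ : ℕ∞) ρ) (hρ0 : ρ 0 = 0) (hρ'0 : deriv ρ 0 = 1)
    (hρeven : ∀ j : ℕ, iteratedDeriv (2 * j) ρ 0 = 0)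
    (hρpos : ∀ r : ℝ, 0 < r → 0 < ρ r) (hρnonneg : ∀ r : ℝ, 0 ≤ r → 0 ≤ ρ r)
    (hρconv : ∀ r : ℝ, 0 ≤ r → 0 ≤ iteratedDeriv 2 ρ r)
    (hσ : IsHyperbolicType σ)
    (Rbar : ℝ) (hRbar : 0 < Rbar) :
    ∀ R : ℝ, Rbar < R → ∃ k : ℝ, 1 ≤ k ∧ ∃ τ : ℝ → ℝ,
      ContDiff ℝ (⊤ : ℕ∞) τ ∧
      (∀ r ∈ Set.Icc (0 : ℝ) Rbar, τ r = ρ r) ∧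
      (∀ r : ℝ, R ≤ r → τ r = sigmaK σ k r) ∧
      (∀ r : ℝ, 0 ≤ r → 0 ≤ iteratedDeriv 2 τ r) ∧
      (∀ r : ℝ, 0 ≤ r → 1 ≤ deriv τ r) ∧
      (∀ r : ℝ, 0 ≤ r → 0 ≤ τ r) := by
  intro R hR
  obtain ⟨φ, N, hφ, hφ0, hφ1, hφ2, hφlow, hφhigh, hφhigh'⟩ := exists_smooth_posPart
  obtain ⟨u, hu, huconv, huρ, huρ', huslope⟩ := exists_affine_extension_right hρsmooth hR
  obtain ⟨c, hac, hcR⟩ := exists_between hR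
  have hc : 0 < c := hRbar.trans hac
  have hR0 : 0 < R := hRbar.trans hR
  have hσ' := hσ
  obtain ⟨hσs, -, -, -, -, hσnonneg, hσconv, -, hσlim⟩ := hσ'
  rw [iteratedDeriv_two_eq] at hρconv hσconv
  obtain ⟨k, hk1, hka, hkc, hkN, hks⟩ := ((eventually_ge_atTop (1 : ℝ)).and
    (((Real.tendsto_sqrt_atTop.atTop_mul_const (sub_pos.2 hac)).eventually_ge_atTop 2).and
    (((hσlim c hc).eventually_ge_atTop N).and
    (((hσlim R hR0).eventually_ge_atTop (u R + N)).and
    ((hσlim R hR0).eventually_ge_atTop (deriv u R)))))).exists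
  have hk : 0 < k := by linarith
  have hsk : 1 ≤ √k := Real.one_le_sqrt.2 hk1
  have hSnonneg : ∀ r, 0 ≤ r → 0 ≤ sigmaK σ k r := fun r hr =>
    mul_nonneg (by positivity) (hσnonneg _ (by positivity))
  have hSs := contDiff_sigmaK hσs k
  have hSconv : ∀ r, 0 ≤ r → 0 ≤ deriv (deriv (sigmaK σ k)) r := fun r hr => by
    rw [deriv_deriv_sigmaK hk]
    exact mul_nonneg (by positivity) (hσconv _ (by positivity))
  obtain ⟨v, hv, hvconv, hvS, hvS', hvleft⟩ := exists_affine_extension_left hSs hcR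
    fun r hr => hSconv r (hc.le.trans hr.1)
  have hnear : ∀ r ∈ Icc 0 Rbar, N ≤ u r - v r := by
    intro r hr
    have h1 := hvleft r (hr.2.trans hac.le)
    have h2 := sqrt_mul_sigmaK_le_deriv hσ hk hc
    have h3 := hSnonneg c hc.le
    have h4 : √k * sigmaK σ k c * (c - Rbar) ≤ deriv (sigmaK σ k) c * (c - r) :=
      mul_le_mul h2 (by linarith [hr.2]) (sub_pos.2 hac).le
        ((mul_nonneg (by positivity) h3).trans h2)
    have h5 : 2 * sigmaK σ k c ≤ √k * (c - Rbar) * sigmaK σ k c :=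
      mul_le_mul_of_nonneg_right hka h3
    have h6 : 0 ≤ u r := by
      rw [huρ (mem_Iic.2 hr.2)]
      exact hρnonneg r hr.1
    linarith
  have hmono : MonotoneOn (v - u) (Ici R) :=
    monotoneOn_of_differentiable (convex_Ici R)
      ((differentiable_of_smooth hv).sub (differentiable_of_smooth hu)) fun x hx => by
      have h1 : MonotoneOn (deriv (sigmaK σ k)) (Ici R) :=
        monotoneOn_of_differentiable (convex_Ici R)
          (differentiable_of_smooth (contDiff_deriv_of_smooth hSs))
          fun y hy => hSconv y (hR0.le.trans hy)
      have h2 := h1 (mem_Ici.2 le_rfl) hx hx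
      have h3 := sqrt_mul_sigmaK_le_deriv hσ hk hR0
      have h4 := le_mul_of_one_le_left (hSnonneg R hR0.le) hsk
      rw [deriv_sub (differentiable_of_smooth hv x) (differentiable_of_smooth hu x), hvS' hx,
        huslope x hx]
      linarith
  have hfar : ∀ r, R ≤ r → u r - v r ≤ -N := by
    intro r hr
    have h1 := hmono (mem_Ici.2 le_rfl) (mem_Ici.2 hr) hr
    have h2 := hvS (mem_Ici.2 (le_refl R))
    simp only [Pi.sub_apply] at h1
    linarith
  obtain ⟨hτ', hτ''⟩ := deriv_regularized_max hu hv hφ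
  have hτ : ContDiff ℝ (⊤ : ℕ∞) (fun r => v r + φ (u r - v r)) :=
    hv.add (hφ.comp (hu.sub hv))
  have hτρ : ∀ r ∈ Icc (0 : ℝ) Rbar, v r + φ (u r - v r) = ρ r := fun r hr => by
    rw [hφhigh _ (hnear r hr), huρ (mem_Iic.2 hr.2)]
    ring
  have hτconv : ∀ r, 0 ≤ r → 0 ≤ deriv (deriv (fun r => v r + φ (u r - v r))) r := by
    intro r hr
    rw [hτ'']
    have h1 := mul_nonneg (hφ0 (u r - v r)) (huconv r (hρconv r hr))
    have h2 := mul_nonneg (sub_nonneg.2 (hφ1 (u r - v r))) (hvconv r (hSconv r hr))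
    have h3 := mul_nonneg (hφ2 (u r - v r)) (mul_self_nonneg (deriv u r - deriv v r))
    linarith
  have h0 : (0 : ℝ) ∈ Icc 0 Rbar := left_mem_Icc.2 hRbar.le
  have hτslope : ∀ r, 0 ≤ r → 1 ≤ deriv (fun r => v r + φ (u r - v r)) r := by
    intro r hr
    have h1 := monotoneOn_of_differentiable (convex_Ici 0)
      (differentiable_of_smooth (contDiff_deriv_of_smooth hτ)) hτconv
      (mem_Ici.2 le_rfl) (mem_Ici.2 hr) hr
    have h2 := hτ' 0
    rw [hφhigh' _ (hnear 0 h0), huρ' (mem_Iic.2 hRbar.le), hρ'0] at h2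
    linarith
  refine ⟨k, hk1, fun r => v r + φ (u r - v r), hτ, hτρ, fun r hr => ?_, ?_, hτslope,
    fun r hr => ?_⟩
  · simp only [hφlow _ (hfar r hr), add_zero]
    exact hvS (mem_Ici.2 hr)
  · rwa [iteratedDeriv_two_eq]
  · have h1 := monotoneOn_of_differentiable (convex_Ici 0) (differentiable_of_smooth hτ)
      (fun x hx => zero_le_one.trans (hτslope x hx)) (mem_Ici.2 le_rfl) (mem_Ici.2 hr) hr
    have h2 := hτρ 0 h0
    rw [hρ0] at h2
    exact h2.symm.le.trans h1
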